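/- Let q ∈ {3, 4, 5, 6, 7, 8, 9, 11, 13, 17, 19} and let B = {(r₁,b₁),…,(r_s,b_s)} be a finite multiset of pairs of positive integers with, for each i, r_i ≥ 2, 0 < b_i ≤ r_i/2, gcd(b_i, r_i) = 1 and gcd(r_i, q) = 1. Set γ = 24 − Σ_i (r_i − 1/r_i), a = (12/((q−1)(q−2)))·(1 − γ/(12q) + Σ_i c_{r_i,b_i,q}(−1)), and χ(t) = 1 + (t(q+t)(q+2t)/12)·a + (t/(12q))·γ + Σ_i c_{r_i,b_i,q}(t). Assume: γ > 0; a > 0; lcm(r₁,…,r_s)·a is an integer; χ(t) = 0 for every integer t with −q < t < 0; q³a ≥ (121/41)γ; and q³a ≤ (64/21)γ if q = 4, q³a ≤ (25/8)γ if q = 5, q³a < 3γ if q ∉ {4, 5}. Then (q, {r₁,…,r_s}) is one of: (4, {7,13}), (5, {3,7,7}), (5, {4,7}), (11, {2,3,5}), with q³a/γ equal to 3, 25/8, 3, 121/41 respectively. (This is the arithmetic content of the paper's computer search in Lemma 2.2, listing all numerical candidates for terminal ℚ-Fano threefolds with qℚ ≥ 3 and c₁³/(c₂c₁) ≥ 121/41.)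 -/

import Mathlib

/-- Reid's correction term `c(r, b, i)`:
`c(r,b,i) = -i(r²-1)/(12r) + Σ_{j=0}^{i-1} (jb mod r)(r - (jb mod r))/(2r)`. -/
def reidC (r b i : ℕ) : ℚ :=
  -(i : ℚ) * ((r : ℚ) ^ 2 - 1) / (12 * r) +
    ∑ j ∈ Finset.range i, (((j * b) % r : ℕ) : ℚ) * ((r : ℚ) - (((j * b) % r : ℕ) : ℚ)) / (2 * r)

/-- The unique `0 ≤ i < r` with `q · i ≡ -t (mod r)` (valid when `gcd q r = 1`). -/
def reidIdx (r q : ℕ) (t : ℤ) : ℕ :=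
  (((-t : ℤ) : ZMod r) * (q : ZMod r)⁻¹).val

/-- Reid's correction term `c_{r,b,q}(t) = c(r, b, i_{r,b,q}(t))`. -/
def reidCq (r b q : ℕ) (t : ℤ) : ℚ :=
  reidC r b (reidIdx r q t)

/-- Common denominator `12 * lcm(1..24)`. -/
abbrev cd : ℕ := 64250746560

/-- Scaled weight `cd * (r - 1/r)`. -/
def wt (r : ℕ) : ℕ := cd * r - cd / r

/-- The index `i < r` with `q * i ≡ k mod r`, found by search. -/
def idx (r q k : ℕ) : ℕ :=
  ((List.range r).find? (fun i => Nat.beq ((q * i) % r) (k % r))).getD 0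

/-- The value of `γ` in terms of scaled weight sum. -/
def gam (S : ℕ) : ℚ := 24 - (S : ℚ) / cd

/-- The value of `a` in terms of scaled sums. -/
def aval (q S C : ℕ) : ℚ :=
  12 / (((q : ℚ) - 1) * ((q : ℚ) - 2)) *
    (1 - gam S / (12 * q) + ((C : ℚ) / cd - 2 * ((S : ℚ) / cd)))

/-- The conclusion of the theorem. -/
def Concl (q : ℕ) (R : Multiset ℕ) (a γ : ℚ) : Prop :=
    (q = 4 ∧ R = ({7, 13} : Multiset ℕ) ∧ (q : ℚ) ^ 3 * a / γ = 3) ∨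
    (q = 5 ∧ R = ({3, 7, 7} : Multiset ℕ) ∧ (q : ℚ) ^ 3 * a / γ = 25/8) ∨
    (q = 5 ∧ R = ({4, 7} : Multiset ℕ) ∧ (q : ℚ) ^ 3 * a / γ = 3) ∨
    (q = 11 ∧ R = ({2, 3, 5} : Multiset ℕ) ∧ (q : ℚ) ^ 3 * a / γ = 121/41)

instance (q : ℕ) (R : Multiset ℕ) (a γ : ℚ) : Decidable (Concl q R a γ) := by
  unfold Concl; infer_instance

/-- Exact test applied to the baskets which survive the two inequalities. -/
def SlowP (q S C : ℕ) (B : Multiset (ℕ × ℕ × ℕ)) : Prop :=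
  ((((B.map Prod.fst).lcm : ℕ) : ℚ) * aval q S C).den ≠ 1 ∨
  1 + ((-2) * ((q : ℚ) + (-2)) * ((q : ℚ) + 2 * (-2)) / 12) * aval q S C
        + ((-2) / (12 * q)) * gam S
        + (B.map fun p => reidC p.1 p.2.1 (idx p.1 q 2)).sum ≠ 0 ∨
  (q ≠ 4 ∧ q ≠ 5 ∧ ¬ ((q : ℚ) ^ 3 * aval q S C < 3 * gam S)) ∨
  Concl q (B.map Prod.fst) (aval q S C) (gam S)

instance (q S C : ℕ) (B : Multiset (ℕ × ℕ × ℕ)) : Decidable (SlowP q S C B) := by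
  unfold SlowP; infer_instance

/-- The lower bound fails. -/
def lowFail (q S C : ℕ) : Bool :=
  Nat.blt (41 * q ^ 2 * ((12 * q - 24) * cd + S + 12 * q * C) + 121 * ((q - 1) * (q - 2)) * S)
    (121 * 24 * cd * ((q - 1) * (q - 2)) + 41 * 24 * q ^ 3 * S)

/-- The (weak) upper bound fails. -/
def upFail (q un ud S C : ℕ) : Bool :=
  Nat.blt (un * 24 * cd * ((q - 1) * (q - 2)) + ud * 24 * q ^ 3 * S)
    (ud * q ^ 2 * ((12 * q - 24) * cd + S + 12 * q * C) + un * ((q - 1) * (q - 2)) * S)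

/-- Test at a leaf of the search tree. -/
def leaf (q un ud S C : ℕ) (acc : List (ℕ × ℕ × ℕ)) : Bool :=
  lowFail q S C || (upFail q un ud S C || decide (SlowP q S C (acc : Multiset (ℕ × ℕ × ℕ))))

/-- The search over all baskets. -/
def search (q un ud : ℕ) : ℕ → List (ℕ × ℕ × ℕ) → ℕ → ℕ → List (ℕ × ℕ × ℕ) → Bool
  | 0, _, _, _, _ => false
  | _ + 1, [], S, C, acc => leaf q un ud S C acc
  | n + 1, e :: ps, S, C, acc =>
    bif Nat.blt (S + wt e.1) (24 * cd) then
      search q un ud n (e :: ps) (S + wt e.1) (C + e.2.2) (e :: acc) &&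
        search q un ud n ps S C acc
    else leaf q un ud S C acc

/-- Scaled shifted correction term. -/
def cf (q : ℕ) (p : ℕ × ℕ) : ℚ :=
  cd * (reidC p.1 p.2 (idx p.1 q 1) + 2 * ((p.1 : ℚ) - 1 / (p.1 : ℚ)))

/-- Correctness and completeness of a table. -/
def tabOk (q : ℕ) (l : List (ℕ × ℕ × ℕ)) : Prop :=
  l.Pairwise (fun x y => x.1 ≤ y.1) ∧
  (∀ e ∈ l, (e.2.2 : ℚ) = cf q (e.1, e.2.1) ∧
    (idx e.1 q 1 < e.1 ∧ (q * idx e.1 q 1) % e.1 = 1 % e.1) ∧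
    (idx e.1 q 2 < e.1 ∧ (q * idx e.1 q 2) % e.1 = 2 % e.1) ∧
    2 ≤ e.1 ∧ cd % e.1 = 0) ∧
  (∀ r ∈ List.range 25, 2 ≤ r → Nat.gcd r q = 1 → ∀ b ∈ List.range 13, 0 < b → 2 * b ≤ r →
    Nat.gcd b r = 1 → (r, b) ∈ l.map (fun e => (e.1, e.2.1)))

instance (q : ℕ) (l : List (ℕ × ℕ × ℕ)) : Decidable (tabOk q l) := by
  unfold tabOk; infer_instance

/-- Baskets points allowed for index 3: `(r, b, scaled and shifted c(-1))`. -/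
def tab3 : List (ℕ × ℕ × ℕ) :=
  [(2, 1, 184720896360), (4, 1, 477864927540), (5, 1, 591106868352), (5, 2, 603957017664),
   (7, 1, 881153095680), (7, 2, 853617061440), (7, 3, 871974417600), (8, 1, 961753362570),
   (8, 3, 993878735850), (10, 1, 1283408662536), (10, 3, 1257708363912), (11, 1, 1320060792960),
   (11, 2, 1390152516480), (11, 3, 1378470562560), (11, 4, 1349265677760),
   (11, 5, 1366788608640), (13, 1, 1690288871040), (13, 2, 1591441568640),
   (13, 3, 1640865219840), (13, 4, 1645807584960), (13, 5, 1606268664000),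
   (13, 6, 1650749950080), (14, 1, 1669372075800), (14, 3, 1761158856600),
   (14, 5, 1751980178520), (16, 1, 2103208031925), (16, 3, 2022894598725),
   (16, 5, 1990769225445), (16, 7, 2006831912085), (17, 1, 2010670421760),
   (17, 2, 2180745927360), (17, 3, 2142951370560), (17, 4, 2090038991040),
   (17, 5, 2150510281920), (17, 6, 2131613003520), (17, 7, 2097597902400),
   (17, 8, 2112715725120), (19, 1, 2522687207040), (19, 2, 2309645257920),
   (19, 3, 2404330568640), (19, 4, 2421238659840), (19, 5, 2360369531520),
   (19, 6, 2414475423360), (19, 7, 2390804095680), (19, 8, 2353606295040),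
   (19, 9, 2431383514560), (20, 1, 2344349115108), (20, 3, 2524251205476),
   (20, 7, 2460000458916), (20, 9, 2537101354788), (22, 1, 2948963242680),
   (22, 3, 2785415887800), (22, 5, 2715324164280), (22, 7, 2802938818680),
   (22, 9, 2791256864760), (23, 1, 2670596248320), (23, 2, 2983469448960),
   (23, 3, 2905251148800), (23, 4, 2821445827200), (23, 5, 2924805723840),
   (23, 6, 2894077105920), (23, 7, 2857761466560), (23, 8, 2880109552320),
   (23, 9, 2896870616640), (23, 10, 2843793912960), (23, 11, 2849380934400)]

/-- Baskets points allowed for index 4: `(r, b, scaled and shifted c(-1))`. -/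
def tab4 : List (ℕ × ℕ × ℕ) :=
  [(3, 1, 328392704640), (5, 1, 616807166976), (5, 2, 603957017664), (7, 1, 835259705280),
   (7, 2, 853617061440), (7, 3, 862795739520), (9, 1, 1158893095360), (9, 2, 1116059264320),
   (9, 4, 1137476179840), (11, 1, 1308378839040), (11, 2, 1360947631680), (11, 3, 1384311539520),
   (11, 4, 1378470562560), (11, 5, 1343424700800), (13, 1, 1710058331520),
   (13, 2, 1621095759360), (13, 3, 1601326298880), (13, 4, 1650749950080),
   (13, 5, 1640865219840), (13, 6, 1635922854720), (15, 1, 1761898250112),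
   (15, 2, 1864699444608), (15, 4, 1890399743232), (15, 7, 1864699444608),
   (17, 1, 2275232319360), (17, 2, 2124054092160), (17, 3, 2086259535360),
   (17, 4, 2161848648960), (17, 5, 2158069193280), (17, 6, 2139171914880),
   (17, 7, 2105156813760), (17, 8, 2184525383040), (19, 1, 2198051856000),
   (19, 2, 2367132768000), (19, 3, 2434765132800), (19, 4, 2400948950400),
   (19, 5, 2329934967360), (19, 6, 2350224676800), (19, 7, 2397567332160),
   (19, 8, 2407712186880), (19, 9, 2316408494400), (21, 1, 2855588736000),
   (21, 2, 2626121784000), (21, 4, 2672015174400), (21, 5, 2690372530560),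
   (21, 8, 2662836496320), (21, 10, 2672015174400), (23, 1, 2617519544640),
   (23, 2, 2868935509440), (23, 3, 2966708384640), (23, 4, 2910838170240),
   (23, 5, 2829826359360), (23, 6, 2852174445120), (23, 7, 2913631680960),
   (23, 8, 2885696573760), (23, 9, 2832619870080), (23, 10, 2882903063040),
   (23, 11, 2843793912960)]

/-- Baskets points allowed for index 5: `(r, b, scaled and shifted c(-1))`. -/
def tab5 : List (ℕ × ℕ × ℕ) :=
  [(2, 1, 184720896360), (3, 1, 335531676480), (4, 1, 461802240900), (6, 1, 754053900600),
   (7, 1, 844438383360), (7, 2, 871974417600), (7, 3, 853617061440), (8, 1, 1001910079170),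
   (8, 3, 1001910079170), (9, 1, 1075605090560), (9, 2, 1097022006080), (9, 4, 1118438921600),
   (11, 1, 1436880332160), (11, 2, 1384311539520), (11, 3, 1360947631680),
   (11, 4, 1366788608640), (11, 5, 1401834470400), (12, 1, 1453226955180),
   (12, 5, 1517477701740), (13, 1, 1660634680320), (13, 2, 1586499203520),
   (13, 3, 1655692315200), (13, 4, 1611211029120), (13, 5, 1645807584960),
   (13, 6, 1630980489600), (14, 1, 1651014719640), (14, 3, 1751980178520),
   (14, 5, 1761158856600), (16, 1, 2139349076865), (16, 3, 1978722210465),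
   (16, 5, 2042972957025), (16, 7, 2010847583745), (17, 1, 2044685522880),
   (17, 2, 2203422661440), (17, 3, 2082480079680), (17, 4, 2131613003520),
   (17, 5, 2158069193280), (17, 6, 2097597902400), (17, 7, 2142951370560),
   (17, 8, 2101377358080), (18, 1, 2328792105640), (18, 5, 2285958274600),
   (18, 7, 2243124443560), (19, 1, 2198051856000), (19, 2, 2319790112640),
   (19, 3, 2394185713920), (19, 4, 2421238659840), (19, 5, 2400948950400),
   (19, 6, 2333316585600), (19, 7, 2346843058560), (19, 8, 2377277622720),
   (19, 9, 2360369531520), (21, 1, 2865787267200), (21, 2, 2682213705600),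
   (21, 4, 2590426924800), (21, 5, 2682213705600), (21, 8, 2608784280960),
   (21, 10, 2718928417920), (22, 1, 2621868532920), (22, 3, 2680278302520),
   (22, 5, 2797097841720), (22, 7, 2779574910840), (22, 9, 2756211003000),
   (23, 1, 3008611045440), (23, 2, 2757195080640), (23, 3, 2980675938240),
   (23, 4, 2843793912960), (23, 5, 2924805723840), (23, 6, 2902457638080),
   (23, 7, 2841000402240), (23, 8, 2933186256000), (23, 9, 2857761466560),
   (23, 10, 2935979766720), (23, 11, 2910838170240), (24, 1, 2718386620950),
   (24, 5, 3039640353750), (24, 7, 2975389607190), (24, 11, 2975389607190)]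

/-- Baskets points allowed for index 6: `(r, b, scaled and shifted c(-1))`. -/
def tab6 : List (ℕ × ℕ × ℕ) :=
  [(5, 1, 591106868352), (5, 2, 591106868352), (7, 1, 890331773760), (7, 2, 871974417600),
   (7, 3, 862795739520), (11, 1, 1314219816000), (11, 2, 1337583723840), (11, 3, 1355106654720),
   (11, 4, 1366788608640), (11, 5, 1372629585600), (13, 1, 1715000696640),
   (13, 2, 1655692315200), (13, 3, 1621095759360), (13, 4, 1611211029120),
   (13, 5, 1626038124480), (13, 6, 1665577045440), (17, 1, 1991773143360),
   (17, 2, 2059803345600), (17, 3, 2108936269440), (17, 4, 2139171914880),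
   (17, 5, 2150510281920), (17, 6, 2142951370560), (17, 7, 2116495180800),
   (17, 8, 2071141712640), (19, 1, 2570029862400), (19, 2, 2448291605760),
   (19, 3, 2373896004480), (19, 4, 2346843058560), (19, 5, 2367132768000),
   (19, 6, 2434765132800), (19, 7, 2421238659840), (19, 8, 2390804095680),
   (19, 9, 2407712186880), (23, 1, 2631487098240), (23, 2, 2765575612800),
   (23, 3, 2860554977280), (23, 4, 2916425191680), (23, 5, 2933186256000),
   (23, 6, 2910838170240), (23, 7, 2849380934400), (23, 8, 2813065295040),
   (23, 9, 2866141998720), (23, 10, 2880109552320), (23, 11, 2854967955840)]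

/-- Baskets points allowed for index 7: `(r, b, scaled and shifted c(-1))`. -/
def tab7 : List (ℕ × ℕ × ℕ) :=
  [(2, 1, 184720896360), (3, 1, 328392704640), (4, 1, 477864927540), (5, 1, 603957017664),
   (5, 2, 603957017664), (6, 1, 718359041400), (8, 1, 1026004109130), (8, 3, 993878735850),
   (9, 1, 1094642348800), (9, 2, 1137476179840), (9, 4, 1116059264320), (10, 1, 1193457617352),
   (10, 3, 1257708363912), (11, 1, 1425198378240), (11, 2, 1355106654720),
   (11, 3, 1366788608640), (11, 4, 1395993493440), (11, 5, 1378470562560),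
   (12, 1, 1515692958780), (12, 5, 1515692958780), (13, 1, 1551902647680),
   (13, 2, 1576614473280), (13, 3, 1596383933760), (13, 4, 1611211029120),
   (13, 5, 1621095759360), (13, 6, 1626038124480), (15, 1, 1993200937728),
   (15, 2, 1928950191168), (15, 4, 1864699444608), (15, 7, 1928950191168),
   (16, 1, 1942581165525), (16, 3, 1958643852165), (16, 5, 1990769225445),
   (16, 7, 2038957285365), (17, 1, 1987993687680), (17, 2, 2139171914880),
   (17, 3, 2176966471680), (17, 4, 2101377358080), (17, 5, 2105156813760),
   (17, 6, 2124054092160), (17, 7, 2158069193280), (17, 8, 2078700624000),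
   (18, 1, 2402561481320), (18, 5, 2252643072680), (18, 7, 2295476903720),
   (19, 1, 2434765132800), (19, 2, 2313026876160), (19, 3, 2431383514560),
   (19, 4, 2340079822080), (19, 5, 2424620278080), (19, 6, 2363751149760),
   (19, 7, 2414475423360), (19, 8, 2384040859200), (19, 9, 2400948950400),
   (20, 1, 2331498965796), (20, 3, 2460000458916), (20, 7, 2524251205476),
   (20, 9, 2460000458916), (22, 1, 3001532035320), (22, 3, 2779574910840),
   (22, 5, 2721165141240), (22, 7, 2826302726520), (22, 9, 2773733933880),
   (23, 1, 2768369123520), (23, 2, 3019785088320), (23, 3, 2796304230720),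
   (23, 4, 2933186256000), (23, 5, 2852174445120), (23, 6, 2874522530880),
   (23, 7, 2935979766720), (23, 8, 2843793912960), (23, 9, 2919218702400),
   (23, 10, 2841000402240), (23, 11, 2866141998720), (24, 1, 2733556936110),
   (24, 5, 2958434549070), (24, 7, 3054810668910), (24, 11, 3022685295630)]

/-- Baskets points allowed for index 8: `(r, b, scaled and shifted c(-1))`. -/
def tab8 : List (ℕ × ℕ × ℕ) :=
  [(3, 1, 335531676480), (5, 1, 591106868352), (5, 2, 603957017664), (7, 1, 844438383360),
   (7, 2, 844438383360), (7, 3, 844438383360), (9, 1, 1161272752640), (9, 2, 1139855837120),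
   (9, 4, 1118438921600), (11, 1, 1401834470400), (11, 2, 1343424700800), (11, 3, 1395993493440),
   (11, 4, 1366788608640), (11, 5, 1384311539520), (13, 1, 1561787377920),
   (13, 2, 1660634680320), (13, 3, 1611211029120), (13, 4, 1606268664000),
   (13, 5, 1645807584960), (13, 6, 1601326298880), (15, 1, 1789026343104),
   (15, 2, 1814726641728), (15, 4, 1853277089664), (15, 7, 1878977388288),
   (17, 1, 2271452863680), (17, 2, 2203422661440), (17, 3, 2154289737600),
   (17, 4, 2124054092160), (17, 5, 2112715725120), (17, 6, 2120274636480),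
   (17, 7, 2146730826240), (17, 8, 2192084294400), (19, 1, 2482107788160),
   (19, 2, 2292737166720), (19, 3, 2448291605760), (19, 4, 2370514386240),
   (19, 5, 2380659240960), (19, 6, 2414475423360), (19, 7, 2343461440320),
   (19, 8, 2424620278080), (19, 9, 2400948950400), (21, 1, 2480282787840),
   (21, 2, 2737285774080), (21, 4, 2608784280960), (21, 5, 2673035027520),
   (21, 8, 2673035027520), (21, 10, 2608784280960), (23, 1, 2670596248320),
   (23, 2, 2746021037760), (23, 3, 2807478273600), (23, 4, 2854967955840),
   (23, 5, 2888490084480), (23, 6, 2908044659520), (23, 7, 2913631680960),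
   (23, 8, 2905251148800), (23, 9, 2882903063040), (23, 10, 2846587423680),
   (23, 11, 2796304230720)]

/-- Baskets points allowed for index 9: `(r, b, scaled and shifted c(-1))`. -/
def tab9 : List (ℕ × ℕ × ℕ) :=
  [(2, 1, 184720896360), (4, 1, 461802240900), (5, 1, 616807166976), (5, 2, 603957017664),
   (7, 1, 862795739520), (7, 2, 862795739520), (7, 3, 862795739520), (8, 1, 969784705890),
   (8, 3, 969784705890), (10, 1, 1296258811848), (10, 3, 1257708363912), (11, 1, 1343424700800),
   (11, 2, 1401834470400), (11, 3, 1349265677760), (11, 4, 1378470562560),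
   (11, 5, 1360947631680), (13, 1, 1537075552320), (13, 2, 1596383933760),
   (13, 3, 1630980489600), (13, 4, 1640865219840), (13, 5, 1626038124480),
   (13, 6, 1586499203520), (14, 1, 1852945637400), (14, 3, 1724444144280),
   (14, 5, 1788694890840), (16, 1, 2026910270385), (16, 3, 2026910270385),
   (16, 5, 2026910270385), (16, 7, 2026910270385), (17, 1, 2025788244480),
   (17, 2, 2052244434240), (17, 3, 2074921168320), (17, 4, 2093818446720),
   (17, 5, 2108936269440), (17, 6, 2120274636480), (17, 7, 2127833547840),
   (17, 8, 2131613003520), (19, 1, 2549740152960), (19, 2, 2478726169920),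
   (19, 3, 2424620278080), (19, 4, 2387422477440), (19, 5, 2367132768000),
   (19, 6, 2363751149760), (19, 7, 2377277622720), (19, 8, 2407712186880),
   (19, 9, 2455054842240), (20, 1, 2431087622964), (20, 3, 2443937772276),
   (20, 7, 2508188518836), (20, 9, 2559589116084), (22, 1, 2510889970680),
   (22, 3, 2802938818680), (22, 5, 2744529049080), (22, 7, 2721165141240),
   (22, 9, 2797097841720), (23, 1, 3159460624320), (23, 2, 2908044659520),
   (23, 3, 2810271784320), (23, 4, 2866141998720), (23, 5, 2947153809600),
   (23, 6, 2924805723840), (23, 7, 2863348488000), (23, 8, 2891283595200),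
   (23, 9, 2944360298880), (23, 10, 2894077105920), (23, 11, 2933186256000)]

/-- Baskets points allowed for index 11: `(r, b, scaled and shifted c(-1))`. -/
def tab11 : List (ℕ × ℕ × ℕ) :=
  [(2, 1, 184720896360), (3, 1, 335531676480), (4, 1, 477864927540), (5, 1, 591106868352),
   (5, 2, 591106868352), (6, 1, 754053900600), (7, 1, 835259705280), (7, 2, 853617061440),
   (7, 3, 862795739520), (8, 1, 961753362570), (8, 3, 993878735850), (9, 1, 1118438921600),
   (9, 2, 1118438921600), (9, 4, 1118438921600), (10, 1, 1219157915976), (10, 3, 1219157915976),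
   (12, 1, 1565665761660), (12, 5, 1501415015100), (13, 1, 1591441568640),
   (13, 2, 1665577045440), (13, 3, 1596383933760), (13, 4, 1640865219840),
   (13, 5, 1606268664000), (13, 6, 1621095759360), (14, 1, 1807052247000),
   (14, 3, 1788694890840), (14, 5, 1751980178520), (15, 1, 1981778582784),
   (15, 2, 1853277089664), (15, 4, 1917527836224), (15, 7, 1917527836224),
   (16, 1, 1878330418965), (16, 3, 1990769225445), (16, 5, 2022894598725),
   (16, 7, 1974706538805), (17, 1, 2282791230720), (17, 2, 2169407560320),
   (17, 3, 2108936269440), (17, 4, 2101377358080), (17, 5, 2146730826240),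
   (17, 6, 2180745927360), (17, 7, 2139171914880), (17, 8, 2150510281920),
   (18, 1, 2093206034920), (18, 5, 2221707528040), (18, 7, 2285958274600),
   (19, 1, 2245394511360), (19, 2, 2458436460480), (19, 3, 2363751149760),
   (19, 4, 2346843058560), (19, 5, 2407712186880), (19, 6, 2353606295040),
   (19, 7, 2377277622720), (19, 8, 2414475423360), (19, 9, 2336698203840),
   (20, 1, 2537101354788), (20, 3, 2537101354788), (20, 7, 2537101354788),
   (20, 9, 2537101354788), (21, 1, 2498640144000), (21, 2, 2526176178240),
   (21, 4, 2572069568640), (21, 5, 2590426924800), (21, 8, 2627141637120),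
   (21, 10, 2636320315200), (23, 1, 3106383920640), (23, 2, 3030959131200),
   (23, 3, 2969501895360), (23, 4, 2922012213120), (23, 5, 2888490084480),
   (23, 6, 2868935509440), (23, 7, 2863348488000), (23, 8, 2871729020160),
   (23, 9, 2894077105920), (23, 10, 2930392745280), (23, 11, 2980675938240),
   (24, 1, 2919170203950), (24, 5, 2951295577230), (24, 7, 2983420950510),
   (24, 11, 3079797070350)]

/-- Baskets points allowed for index 13: `(r, b, scaled and shifted c(-1))`. -/
def tab13 : List (ℕ × ℕ × ℕ) :=
  [(2, 1, 184720896360), (3, 1, 328392704640), (4, 1, 461802240900), (5, 1, 591106868352),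
   (5, 2, 603957017664), (6, 1, 718359041400), (7, 1, 890331773760), (7, 2, 871974417600),
   (7, 3, 862795739520), (8, 1, 1001910079170), (8, 3, 1001910079170), (9, 1, 1158893095360),
   (9, 2, 1116059264320), (9, 4, 1137476179840), (10, 1, 1283408662536), (10, 3, 1257708363912),
   (11, 1, 1372629585600), (11, 2, 1372629585600), (11, 3, 1372629585600),
   (11, 4, 1372629585600), (11, 5, 1372629585600), (12, 1, 1467504898860),
   (12, 5, 1467504898860), (14, 1, 1834588281240), (14, 3, 1788694890840),
   (14, 5, 1761158856600), (15, 1, 1838999145984), (15, 2, 1928950191168),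
   (15, 4, 1903249892544), (15, 7, 1864699444608), (16, 1, 1882346090625),
   (16, 3, 2042972957025), (16, 5, 1978722210465), (16, 7, 2010847583745),
   (17, 1, 1980434776320), (17, 2, 2093818446720), (17, 3, 2154289737600),
   (17, 4, 2161848648960), (17, 5, 2116495180800), (17, 6, 2082480079680),
   (17, 7, 2124054092160), (17, 8, 2112715725120), (18, 1, 2145558495080),
   (18, 5, 2295476903720), (18, 7, 2252643072680), (19, 1, 2218341565440),
   (19, 2, 2289355548480), (19, 3, 2343461440320), (19, 4, 2380659240960),
   (19, 5, 2400948950400), (19, 6, 2404330568640), (19, 7, 2390804095680),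
   (19, 8, 2360369531520), (19, 9, 2313026876160), (20, 1, 2713790907828),
   (20, 3, 2508188518836), (20, 7, 2572439265396), (20, 9, 2521038668148),
   (21, 1, 2745444599040), (21, 2, 2525156325120), (21, 4, 2607764427840),
   (21, 5, 2653657818240), (21, 8, 2681193852480), (21, 10, 2672015174400),
   (22, 1, 3007373012280), (22, 3, 2686119279480), (22, 5, 2814620772600),
   (22, 7, 2750370026040), (22, 9, 2814620772600), (23, 1, 3106383920640),
   (23, 2, 2793510720000), (23, 3, 2871729020160), (23, 4, 2955534341760),
   (23, 5, 2852174445120), (23, 6, 2882903063040), (23, 7, 2919218702400),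
   (23, 8, 2896870616640), (23, 9, 2880109552320), (23, 10, 2933186256000),
   (23, 11, 2927599234560), (24, 1, 3046779325590), (24, 5, 3046779325590),
   (24, 7, 3046779325590), (24, 11, 3046779325590)]

/-- Baskets points allowed for index 17: `(r, b, scaled and shifted c(-1))`. -/
def tab17 : List (ℕ × ℕ × ℕ) :=
  [(2, 1, 184720896360), (3, 1, 335531676480), (4, 1, 461802240900), (5, 1, 603957017664),
   (5, 2, 603957017664), (6, 1, 754053900600), (7, 1, 881153095680), (7, 2, 853617061440),
   (7, 3, 871974417600), (8, 1, 969784705890), (8, 3, 969784705890), (9, 1, 1161272752640),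
   (9, 2, 1139855837120), (9, 4, 1118438921600), (10, 1, 1193457617352), (10, 3, 1257708363912),
   (11, 1, 1314219816000), (11, 2, 1337583723840), (11, 3, 1355106654720),
   (11, 4, 1366788608640), (11, 5, 1372629585600), (12, 1, 1453226955180),
   (12, 5, 1517477701740), (13, 1, 1710058331520), (13, 2, 1621095759360),
   (13, 3, 1601326298880), (13, 4, 1650749950080), (13, 5, 1640865219840),
   (13, 6, 1635922854720), (14, 1, 1669372075800), (14, 3, 1761158856600),
   (14, 5, 1751980178520), (15, 1, 1878977388288), (15, 2, 1878977388288),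
   (15, 4, 1878977388288), (15, 7, 1878977388288), (16, 1, 1962659523825),
   (16, 3, 1962659523825), (16, 5, 1962659523825), (16, 7, 1962659523825),
   (18, 1, 2371625936680), (18, 5, 2285958274600), (18, 7, 2264541359080),
   (19, 1, 2333316585600), (19, 2, 2455054842240), (19, 3, 2336698203840),
   (19, 4, 2428001896320), (19, 5, 2343461440320), (19, 6, 2404330568640),
   (19, 7, 2353606295040), (19, 8, 2384040859200), (19, 9, 2367132768000),
   (20, 1, 2636690011956), (20, 3, 2572439265396), (20, 7, 2508188518836),
   (20, 9, 2508188518836), (21, 1, 2406853363200), (21, 2, 2590426924800),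
   (21, 4, 2682213705600), (21, 5, 2590426924800), (21, 8, 2663856349440),
   (21, 10, 2553712212480), (22, 1, 2849666634360), (22, 3, 2837984680440),
   (22, 5, 2814620772600), (22, 7, 2779574910840), (22, 9, 2732847095160),
   (23, 1, 3162254135040), (23, 2, 2966708384640), (23, 3, 2854967955840),
   (23, 4, 2827032848640), (23, 5, 2882903063040), (23, 6, 2958327852480),
   (23, 7, 2924805723840), (23, 8, 2910838170240), (23, 9, 2852174445120),
   (23, 10, 2877316041600), (23, 11, 2986262959680), (24, 1, 3264517966710),
   (24, 5, 3007514980470), (24, 7, 3071765727030), (24, 11, 3007514980470)]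

/-- Baskets points allowed for index 19: `(r, b, scaled and shifted c(-1))`. -/
def tab19 : List (ℕ × ℕ × ℕ) :=
  [(2, 1, 184720896360), (3, 1, 328392704640), (4, 1, 477864927540), (5, 1, 616807166976),
   (5, 2, 603957017664), (6, 1, 718359041400), (7, 1, 844438383360), (7, 2, 871974417600),
   (7, 3, 853617061440), (8, 1, 961753362570), (8, 3, 993878735850), (9, 1, 1094642348800),
   (9, 2, 1094642348800), (9, 4, 1094642348800), (10, 1, 1296258811848), (10, 3, 1257708363912),
   (11, 1, 1401834470400), (11, 2, 1343424700800), (11, 3, 1395993493440),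
   (11, 4, 1366788608640), (11, 5, 1384311539520), (12, 1, 1515692958780),
   (12, 5, 1515692958780), (13, 1, 1715000696640), (13, 2, 1655692315200),
   (13, 3, 1621095759360), (13, 4, 1611211029120), (13, 5, 1626038124480),
   (13, 6, 1665577045440), (14, 1, 1651014719640), (14, 3, 1751980178520),
   (14, 5, 1761158856600), (15, 1, 1761898250112), (15, 2, 1864699444608),
   (15, 4, 1890399743232), (15, 7, 1864699444608), (16, 1, 2103208031925),
   (16, 3, 2022894598725), (16, 5, 1990769225445), (16, 7, 2006831912085),
   (17, 1, 2131613003520), (17, 2, 2131613003520), (17, 3, 2131613003520),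
   (17, 4, 2131613003520), (17, 5, 2131613003520), (17, 6, 2131613003520),
   (17, 7, 2131613003520), (17, 8, 2131613003520), (18, 1, 2209809241640),
   (18, 5, 2209809241640), (18, 7, 2209809241640), (20, 1, 2639902549284),
   (20, 3, 2588501952036), (20, 7, 2524251205476), (20, 9, 2511401056164),
   (21, 1, 2580228393600), (21, 2, 2717908564800), (21, 4, 2690372530560),
   (21, 5, 2589407071680), (21, 8, 2644479140160), (21, 10, 2626121784000),
   (22, 1, 2540094855480), (22, 3, 2826302726520), (22, 5, 2756211003000),
   (22, 7, 2715324164280), (22, 9, 2767892956920), (23, 1, 3139906049280),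
   (23, 2, 2846587423680), (23, 3, 2807478273600), (23, 4, 2958327852480),
   (23, 5, 2913631680960), (23, 6, 2866141998720), (23, 7, 2880109552320),
   (23, 8, 2955534341760), (23, 9, 2899664127360), (23, 10, 2841000402240),
   (23, 11, 2972295406080), (24, 1, 3311813655150), (24, 5, 3086936042190),
   (24, 7, 2990559922350), (24, 11, 3022685295630)]

theorem tabOk3 : tabOk 3 tab3 := by decide +kernel

theorem search3 : search 3 3 1 120 tab3 0 0 [] = true := by decide +kernel

theorem tabOk4 : tabOk 4 tab4 := by decide +kernel

theorem search4 : search 4 64 21 120 tab4 0 0 [] = true := by decide +kernel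

theorem tabOk5 : tabOk 5 tab5 := by decide +kernel

theorem search5 : search 5 25 8 120 tab5 0 0 [] = true := by decide +kernel

theorem tabOk6 : tabOk 6 tab6 := by decide +kernel

theorem search6 : search 6 3 1 120 tab6 0 0 [] = true := by decide +kernel

theorem tabOk7 : tabOk 7 tab7 := by decide +kernel

theorem search7 : search 7 3 1 120 tab7 0 0 [] = true := by decide +kernel

theorem tabOk8 : tabOk 8 tab8 := by decide +kernel

theorem search8 : search 8 3 1 120 tab8 0 0 [] = true := by decide +kernel

theorem tabOk9 : tabOk 9 tab9 := by decide +kernel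

theorem search9 : search 9 3 1 120 tab9 0 0 [] = true := by decide +kernel

theorem tabOk11 : tabOk 11 tab11 := by decide +kernel

theorem search11 : search 11 3 1 120 tab11 0 0 [] = true := by decide +kernel

theorem tabOk13 : tabOk 13 tab13 := by decide +kernel

theorem search13 : search 13 3 1 120 tab13 0 0 [] = true := by decide +kernel

theorem tabOk17 : tabOk 17 tab17 := by decide +kernel

theorem search17 : search 17 3 1 120 tab17 0 0 [] = true := by decide +kernel

theorem tabOk19 : tabOk 19 tab19 := by decide +kernel

theorem search19 : search 19 3 1 120 tab19 0 0 [] = true := by decide +kernel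

theorem wt_mono {r s : ℕ} (hr : 0 < r) (h : r ≤ s) : wt r ≤ wt s := by
  unfold wt
  exact tsub_le_tsub (Nat.mul_le_mul_left _ h) (Nat.div_le_div_left h hr)

theorem search_sound (q un ud : ℕ) (n : ℕ) : ∀ (l : List (ℕ × ℕ × ℕ)) (S C : ℕ)
    (acc : List (ℕ × ℕ × ℕ)), search q un ud n l S C acc = true →
    l.Pairwise (fun x y => x.1 ≤ y.1) → (∀ e ∈ l, 0 < e.1) →
    ∀ B : Multiset (ℕ × ℕ × ℕ), (∀ e ∈ B, e ∈ l) →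
    S + (B.map fun e => wt e.1).sum < 24 * cd →
    lowFail q (S + (B.map fun e => wt e.1).sum) (C + (B.map fun e => e.2.2).sum) = true ∨
    upFail q un ud (S + (B.map fun e => wt e.1).sum) (C + (B.map fun e => e.2.2).sum) = true ∨
    SlowP q (S + (B.map fun e => wt e.1).sum) (C + (B.map fun e => e.2.2).sum)
      (B + (acc : Multiset (ℕ × ℕ × ℕ))) := by
  have hleaf : ∀ (S C : ℕ) (acc : List (ℕ × ℕ × ℕ)) (B : Multiset (ℕ × ℕ × ℕ)), B = 0 →
      leaf q un ud S C acc = true →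
      lowFail q (S + (B.map fun e => wt e.1).sum) (C + (B.map fun e => e.2.2).sum) = true ∨
      upFail q un ud (S + (B.map fun e => wt e.1).sum) (C + (B.map fun e => e.2.2).sum) = true ∨
      SlowP q (S + (B.map fun e => wt e.1).sum) (C + (B.map fun e => e.2.2).sum)
        (B + (acc : Multiset (ℕ × ℕ × ℕ))) := by
    intro S C acc B hB h
    subst hB
    simpa [leaf] using h
  induction n with
  | zero => intro l S C acc h; simp [search] at h
  | succ n ih =>
    intro l S C acc h hs hp B hB hlt
    cases l with
    | nil =>
      refine hleaf S C acc B ?_ (by simpa [search] using h)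
      exact Multiset.eq_zero_of_forall_notMem (fun e he => by simpa using hB e he)
    | cons e ps =>
      by_cases hc : S + wt e.1 < 24 * cd
      · have hc' : Nat.blt (S + wt e.1) (24 * cd) = true := by
          simpa [Nat.blt_eq] using hc
        rw [search, hc', cond_true, Bool.and_eq_true] at h
        by_cases heB : e ∈ B
        · obtain ⟨B', rfl⟩ := Multiset.exists_cons_of_mem heB
          have := ih (e :: ps) _ _ _ h.1 hs hp B'
            (fun x hx => hB x (Multiset.mem_cons_of_mem hx))
            (by simpa [add_assoc] using hlt)
          have e1 : e ::ₘ B' + (acc : Multiset (ℕ × ℕ × ℕ)) =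
              B' + ((e :: acc : List (ℕ × ℕ × ℕ)) : Multiset (ℕ × ℕ × ℕ)) := by
            rw [← Multiset.cons_coe, Multiset.cons_add, Multiset.add_cons]
          rw [e1]
          simpa only [Multiset.map_cons, Multiset.sum_cons, ← add_assoc] using this
        · refine ih ps _ _ _ h.2 (List.pairwise_cons.1 hs).2
            (fun x hx => hp x (List.mem_cons_of_mem _ hx)) B (fun x hx => ?_) hlt
          rcases List.mem_cons.1 (hB x hx) with rfl | h'
          · exact absurd hx heB
          · exact h'
      · have hc' : Nat.blt (S + wt e.1) (24 * cd) = false := by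
          rw [Bool.eq_false_iff]; intro h'; exact hc (by simpa [Nat.blt_eq] using h')
        rw [search, hc', cond_false] at h
        refine hleaf S C acc B ?_ h
        refine Multiset.eq_zero_of_forall_notMem (fun x hx => hc ?_)
        have h1 : wt x.1 ≤ (B.map fun e => wt e.1).sum :=
          Multiset.le_sum_of_mem (Multiset.mem_map_of_mem (fun e : ℕ × ℕ × ℕ => wt e.1) hx)
        have h2 : wt e.1 ≤ wt x.1 := by
          refine wt_mono (hp e List.mem_cons_self) ?_
          rcases List.mem_cons.1 (hB x hx) with rfl | h'
          · exact le_rfl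
          · exact (List.pairwise_cons.1 hs).1 x h'
        omega

theorem reidIdx_eq {r q k i : ℕ} (hr : 2 ≤ r) (hco : Nat.gcd r q = 1) (hi : i < r)
    (h : (q * i) % r = k % r) : reidIdx r q (-(k : ℤ)) = i := by
  unfold reidIdx
  haveI : NeZero r := ⟨by omega⟩
  have h1 : ((q * i : ℕ) : ZMod r) = (k : ZMod r) := (ZMod.natCast_eq_natCast_iff' _ _ _).2 h
  have h2 : (q : ZMod r) * (q : ZMod r)⁻¹ = 1 :=
    ZMod.coe_mul_inv_eq_one q (Nat.coprime_comm.1 hco)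
  have h3 : (((-(-(k : ℤ)) : ℤ) : ZMod r) * (q : ZMod r)⁻¹) = ((i : ℕ) : ZMod r) := by
    push_cast at h1 ⊢
    rw [neg_neg, ← h1]
    calc (q : ZMod r) * i * (q : ZMod r)⁻¹ = i * ((q : ZMod r) * (q : ZMod r)⁻¹) := by ring
      _ = i := by rw [h2, mul_one]
  rw [h3, ZMod.val_natCast_of_lt hi]

theorem wt_cast {r : ℕ} (hr : 2 ≤ r) (hd : cd % r = 0) :
    (wt r : ℚ) = cd * ((r : ℚ) - 1 / (r : ℚ)) := by
  have hr0 : (r : ℚ) ≠ 0 := by positivity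
  obtain ⟨m, hm⟩ := Nat.dvd_of_mod_eq_zero hd
  have hdiv : cd / r = m := by rw [hm]; exact Nat.mul_div_cancel_left m (by omega)
  have hle : cd / r ≤ cd * r := (Nat.div_le_self _ _).trans (Nat.le_mul_of_pos_right _ (by omega))
  unfold wt
  rw [Nat.cast_sub hle, hdiv, hm]
  push_cast
  field_simp

theorem final (q un ud : ℕ) (l : List (ℕ × ℕ × ℕ)) (hl : tabOk q l)
    (hsearch : search q un ud 120 l 0 0 [] = true) (hq3 : 3 ≤ q) (hud : 0 < ud)
    (B : Multiset (ℕ × ℕ)) (γ a : ℚ) (χ : ℤ → ℚ)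
    (hB : ∀ p ∈ B, 2 ≤ p.1 ∧ 0 < p.2 ∧ (p.2 : ℚ) ≤ (p.1 : ℚ) / 2 ∧
      Nat.gcd p.2 p.1 = 1 ∧ Nat.gcd p.1 q = 1)
    (hγ : γ = 24 - (B.map fun p => (p.1 : ℚ) - 1 / (p.1 : ℚ)).sum)
    (ha : a = 12 / (((q : ℚ) - 1) * ((q : ℚ) - 2)) *
      (1 - γ / (12 * q) + (B.map fun p => reidCq p.1 p.2 q (-1)).sum))
    (hχ : ∀ t : ℤ, χ t =
      1 + ((t : ℚ) * ((q : ℚ) + (t : ℚ)) * ((q : ℚ) + 2 * (t : ℚ)) / 12) * a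
        + ((t : ℚ) / (12 * q)) * γ + (B.map fun p => reidCq p.1 p.2 q t).sum)
    (hγpos : 0 < γ)
    (hlcm : ∃ z : ℤ, (((B.map Prod.fst).lcm : ℕ) : ℚ) * a = (z : ℚ))
    (hvan : ∀ t : ℤ, -(q : ℤ) < t → t < 0 → χ t = 0)
    (hlb : (121/41) * γ ≤ (q : ℚ) ^ 3 * a)
    (hub : (q : ℚ) ^ 3 * a * ud ≤ un * γ)
    (hother : q ≠ 4 → q ≠ 5 → (q : ℚ) ^ 3 * a < 3 * γ) :
    Concl q (B.map Prod.fst) a γ := by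
  obtain ⟨hsort, hent, hcomp⟩ := hl
  have hcd : (0 : ℚ) < (cd : ℚ) := by norm_num
  -- every pair occurs in the table
  have hmem : ∀ p ∈ B, ∃ c : ℕ, (p.1, p.2, c) ∈ l := by
    intro p hp
    obtain ⟨h1, h2, h3, h4, h5⟩ := hB p hp
    have hle : (p.1 : ℚ) - 1 / (p.1 : ℚ) ≤
        (B.map fun p => (p.1 : ℚ) - 1 / (p.1 : ℚ)).sum := by
      refine Multiset.single_le_sum ?_ _
        (Multiset.mem_map_of_mem (fun p : ℕ × ℕ => (p.1 : ℚ) - 1 / (p.1 : ℚ)) hp)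
      intro x hx
      obtain ⟨y, hy, rfl⟩ := Multiset.mem_map.1 hx
      have hy2 : (2 : ℚ) ≤ (y.1 : ℚ) := by exact_mod_cast (hB y hy).1
      have : 1 / (y.1 : ℚ) ≤ 1 := by rw [div_le_one (by linarith)]; linarith
      linarith
    have hp2 : (2 : ℚ) ≤ (p.1 : ℚ) := by exact_mod_cast h1
    have hinv : 1 / (p.1 : ℚ) ≤ 1 / 2 := one_div_le_one_div_of_le (by norm_num) hp2
    have hlt : (p.1 : ℚ) < 25 := by linarith
    have hlt' : p.1 < 25 := by exact_mod_cast hlt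
    have h3' : 2 * p.2 ≤ p.1 := by
      have : (2 : ℚ) * p.2 ≤ p.1 := by linarith
      exact_mod_cast this
    have := hcomp p.1 (List.mem_range.2 hlt') h1 h5 p.2 (List.mem_range.2 (by omega)) h2 h3' h4
    obtain ⟨e, he, heq⟩ := List.mem_map.1 this
    refine ⟨e.2.2, ?_⟩
    have e1 : e.1 = p.1 := congrArg Prod.fst heq
    have e2 : e.2.1 = p.2 := congrArg Prod.snd heq
    rw [← e1, ← e2]; exact he
  classical
  let f : ℕ × ℕ → ℕ × ℕ × ℕ := fun p => (p.1, p.2, (cf q p).num.toNat)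
  have hf : ∀ p ∈ B, f p ∈ l ∧ ((f p).2.2 : ℚ) = cf q p := by
    intro p hp
    obtain ⟨c, hc⟩ := hmem p hp
    have h1 := (hent _ hc).1
    have h2 : (cf q p).num.toNat = c := by
      have : cf q p = (c : ℚ) := h1.symm
      rw [this]; simp
    have h3 : f p = (p.1, p.2, c) := by simp only [f, h2]
    exact ⟨h3 ▸ hc, by rw [h3]; exact h1⟩
  have hfst : ((B.map f).map fun e => wt e.1).sum = (B.map fun p => wt p.1).sum := by
    rw [Multiset.map_map]; rfl
  have hR : (B.map f).map Prod.fst = B.map Prod.fst := by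
    rw [Multiset.map_map]; rfl
  set S := ((B.map f).map fun e => wt e.1).sum with hS
  set C := ((B.map f).map fun e => e.2.2).sum with hC
  have hSq : (S : ℚ) = cd * (B.map fun p => (p.1 : ℚ) - 1 / (p.1 : ℚ)).sum := by
    rw [hfst, ← Nat.coe_castAddMonoidHom, map_multiset_sum, Multiset.map_map,
      ← Multiset.sum_map_mul_left]
    refine congrArg Multiset.sum (Multiset.map_congr rfl fun p hp => ?_)
    have := hent _ (hf p hp).1
    exact wt_cast this.2.2.2.1 this.2.2.2.2
  have hidx1 : ∀ p ∈ B, reidCq p.1 p.2 q (-1) = reidC p.1 p.2 (idx p.1 q 1) := by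
    intro p hp
    have := hent _ (hf p hp).1
    have h := reidIdx_eq this.2.2.2.1 (hB p hp).2.2.2.2 this.2.1.1 this.2.1.2
    unfold reidCq
    exact congrArg _ (by simpa using h)
  have hidx2 : ∀ p ∈ B, reidCq p.1 p.2 q (-2) = reidC p.1 p.2 (idx p.1 q 2) := by
    intro p hp
    have := hent _ (hf p hp).1
    have h := reidIdx_eq this.2.2.2.1 (hB p hp).2.2.2.2 this.2.2.1.1 this.2.2.1.2
    unfold reidCq
    exact congrArg _ (by simpa using h)
  have hCq : (C : ℚ) = cd * ((B.map fun p => reidCq p.1 p.2 q (-1)).sum +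
      2 * (B.map fun p => (p.1 : ℚ) - 1 / (p.1 : ℚ)).sum) := by
    rw [hC, ← Nat.coe_castAddMonoidHom, map_multiset_sum, Multiset.map_map, Multiset.map_map,
      ← Multiset.sum_map_mul_left, ← Multiset.sum_map_add, ← Multiset.sum_map_mul_left]
    refine congrArg Multiset.sum (Multiset.map_congr rfl fun p hp => ?_)
    rw [hidx1 p hp]
    exact (hf p hp).2
  have hgam : gam S = γ := by
    rw [hγ, gam, hSq]; field_simp
  have haval : aval q S C = a := by
    rw [ha, aval, hgam, hCq, hSq]; field_simp; ring
  have hSlt : 0 + S < 24 * cd := by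
    have : (0 : ℚ) < 24 - (S : ℚ) / cd := by rw [← hgam] at hγpos; exact hγpos
    have h2 : (S : ℚ) / cd < 24 := by linarith
    rw [div_lt_iff₀ hcd] at h2
    rw [zero_add]
    exact_mod_cast h2
  have key := search_sound q un ud 120 l 0 0 [] hsearch hsort
    (fun e he => by have := (hent e he).2.2.2.1; omega) (B.map f)
    (fun e he => by
      obtain ⟨p, hp, rfl⟩ := Multiset.mem_map.1 he
      exact (hf p hp).1) hSlt
  rw [← hS, ← hC, zero_add, zero_add, Multiset.coe_nil, add_zero] at key
  -- scaled form of `a`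
  have hq3' : (3 : ℚ) ≤ (q : ℚ) := by exact_mod_cast hq3
  have hA : (q : ℚ) ^ 3 * a * (((q : ℚ) - 1) * ((q : ℚ) - 2)) * cd =
      (q : ℚ) ^ 2 * ((12 * q - 24) * cd + S + 12 * q * C - 24 * q * S) := by
    have h1 : (q : ℚ) - 1 ≠ 0 := by linarith
    have h2 : (q : ℚ) - 2 ≠ 0 := by linarith
    have h3 : (q : ℚ) ≠ 0 := by linarith
    rw [← haval, aval, gam]
    field_simp
    ring
  have hG : γ * cd = 24 * cd - S := by
    rw [← hgam, gam]; field_simp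
  have hD : (0 : ℚ) < ((q : ℚ) - 1) * ((q : ℚ) - 2) * cd :=
    mul_pos (mul_pos (by linarith) (by linarith)) hcd
  have c1 : ((q - 1 : ℕ) : ℚ) = (q : ℚ) - 1 := by
    rw [Nat.cast_sub (by omega)]; simp
  have c2 : ((q - 2 : ℕ) : ℚ) = (q : ℚ) - 2 := by
    rw [Nat.cast_sub (by omega)]; simp
  have c3 : ((12 * q - 24 : ℕ) : ℚ) = 12 * (q : ℚ) - 24 := by
    rw [Nat.cast_sub (by omega)]; simp
  rcases key with key | key | key
  · exfalso
    rw [lowFail, Nat.blt_eq, ← Nat.cast_lt (α := ℚ)] at key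
    generalize cd = M at *
    push_cast [c1, c2, c3] at key
    have h := mul_le_mul_of_nonneg_right hlb hD.le
    have e1 : (121 / 41 * γ) * (((q : ℚ) - 1) * ((q : ℚ) - 2) * M) =
      121 / 41 * (((q : ℚ) - 1) * ((q : ℚ) - 2)) * (24 * M - S) := by rw [← hG]; ring
    have e2 : (q : ℚ) ^ 3 * a * (((q : ℚ) - 1) * ((q : ℚ) - 2) * M) =
      (q : ℚ) ^ 2 * ((12 * q - 24) * M + S + 12 * q * C - 24 * q * S) := by rw [← hA]; ring
    rw [e1, e2] at h
    linarith
  · exfalso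
    rw [upFail, Nat.blt_eq, ← Nat.cast_lt (α := ℚ)] at key
    generalize cd = M at *
    push_cast [c1, c2, c3] at key
    have h := mul_le_mul_of_nonneg_right hub hD.le
    have e1 : (un * γ) * (((q : ℚ) - 1) * ((q : ℚ) - 2) * M) =
      un * (((q : ℚ) - 1) * ((q : ℚ) - 2)) * (24 * M - S) := by rw [← hG]; ring
    have e2 : (q : ℚ) ^ 3 * a * ud * (((q : ℚ) - 1) * ((q : ℚ) - 2) * M) =
      ud * ((q : ℚ) ^ 2 * ((12 * q - 24) * M + S + 12 * q * C - 24 * q * S)) := by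
      rw [← hA]; ring
    rw [e1, e2] at h
    linarith
  · unfold SlowP at key
    rw [haval, hgam, hR] at key
    rcases key with key | key | key | key
    · exfalso
      obtain ⟨z, hz⟩ := hlcm
      rw [hz] at key
      simp at key
    · exfalso
      apply key
      have h0 := hvan (-2) (by omega) (by norm_num)
      rw [hχ] at h0
      rw [Multiset.map_congr rfl hidx2] at h0
      rw [Multiset.map_map]
      push_cast at h0
      exact h0
    · exact absurd (hother key.1 key.2.1) key.2.2
    · exact key

theorem stmt_9 (q : ℕ) (B : Multiset (ℕ × ℕ)) (γ a : ℚ) (χ : ℤ → ℚ)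
    (hq : q ∈ ({3, 4, 5, 6, 7, 8, 9, 11, 13, 17, 19} : Set ℕ))
    (hB : ∀ p ∈ B, 2 ≤ p.1 ∧ 0 < p.2 ∧ (p.2 : ℚ) ≤ (p.1 : ℚ) / 2 ∧
      Nat.gcd p.2 p.1 = 1 ∧ Nat.gcd p.1 q = 1)
    (hγ : γ = 24 - (B.map fun p => (p.1 : ℚ) - 1 / (p.1 : ℚ)).sum)
    (ha : a = 12 / (((q : ℚ) - 1) * ((q : ℚ) - 2)) *
      (1 - γ / (12 * q) + (B.map fun p => reidCq p.1 p.2 q (-1)).sum))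
    (hχ : ∀ t : ℤ, χ t =
      1 + ((t : ℚ) * ((q : ℚ) + (t : ℚ)) * ((q : ℚ) + 2 * (t : ℚ)) / 12) * a
        + ((t : ℚ) / (12 * q)) * γ + (B.map fun p => reidCq p.1 p.2 q t).sum)
    (hγpos : 0 < γ) (hapos : 0 < a)
    (hlcm : ∃ z : ℤ, (((B.map Prod.fst).lcm : ℕ) : ℚ) * a = (z : ℚ))
    (hvan : ∀ t : ℤ, -(q : ℤ) < t → t < 0 → χ t = 0)
    (hlb : (121/41) * γ ≤ (q : ℚ) ^ 3 * a)
    (h4 : q = 4 → (q : ℚ) ^ 3 * a ≤ (64/21) * γ)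
    (h5 : q = 5 → (q : ℚ) ^ 3 * a ≤ (25/8) * γ)
    (hother : q ≠ 4 → q ≠ 5 → (q : ℚ) ^ 3 * a < 3 * γ) :
    (q = 4 ∧ B.map Prod.fst = ({7, 13} : Multiset ℕ) ∧ (q : ℚ) ^ 3 * a / γ = 3) ∨
    (q = 5 ∧ B.map Prod.fst = ({3, 7, 7} : Multiset ℕ) ∧ (q : ℚ) ^ 3 * a / γ = 25/8) ∨
    (q = 5 ∧ B.map Prod.fst = ({4, 7} : Multiset ℕ) ∧ (q : ℚ) ^ 3 * a / γ = 3) ∨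
    (q = 11 ∧ B.map Prod.fst = ({2, 3, 5} : Multiset ℕ) ∧ (q : ℚ) ^ 3 * a / γ = 121/41) := by
  
  simp only [Set.mem_insert_iff, Set.mem_singleton_iff] at hq
  rcases hq with rfl | rfl | rfl | rfl | rfl | rfl | rfl | rfl | rfl | rfl | rfl
  · exact final 3 3 1 tab3 tabOk3 search3
      (by norm_num) (by norm_num) B γ a χ hB hγ ha hχ hγpos hlcm hvan hlb
      (by norm_num at h4 h5 hother ⊢; linarith) hother
  · exact final 4 64 21 tab4 tabOk4 search4
      (by norm_num) (by norm_num) B γ a χ hB hγ ha hχ hγpos hlcm hvan hlb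
      (by norm_num at h4 h5 hother ⊢; linarith) hother
  · exact final 5 25 8 tab5 tabOk5 search5
      (by norm_num) (by norm_num) B γ a χ hB hγ ha hχ hγpos hlcm hvan hlb
      (by norm_num at h4 h5 hother ⊢; linarith) hother
  · exact final 6 3 1 tab6 tabOk6 search6
      (by norm_num) (by norm_num) B γ a χ hB hγ ha hχ hγpos hlcm hvan hlb
      (by norm_num at h4 h5 hother ⊢; linarith) hother
  · exact final 7 3 1 tab7 tabOk7 search7
      (by norm_num) (by norm_num) B γ a χ hB hγ ha hχ hγpos hlcm hvan hlb
      (by norm_num at h4 h5 hother ⊢; linarith) hother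
  · exact final 8 3 1 tab8 tabOk8 search8
      (by norm_num) (by norm_num) B γ a χ hB hγ ha hχ hγpos hlcm hvan hlb
      (by norm_num at h4 h5 hother ⊢; linarith) hother
  · exact final 9 3 1 tab9 tabOk9 search9
      (by norm_num) (by norm_num) B γ a χ hB hγ ha hχ hγpos hlcm hvan hlb
      (by norm_num at h4 h5 hother ⊢; linarith) hother
  · exact final 11 3 1 tab11 tabOk11 search11
      (by norm_num) (by norm_num) B γ a χ hB hγ ha hχ hγpos hlcm hvan hlb
      (by norm_num at h4 h5 hother ⊢; linarith) hother
  · exact final 13 3 1 tab13 tabOk13 search13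
      (by norm_num) (by norm_num) B γ a χ hB hγ ha hχ hγpos hlcm hvan hlb
      (by norm_num at h4 h5 hother ⊢; linarith) hother
  · exact final 17 3 1 tab17 tabOk17 search17
      (by norm_num) (by norm_num) B γ a χ hB hγ ha hχ hγpos hlcm hvan hlb
      (by norm_num at h4 h5 hother ⊢; linarith) hother
  · exact final 19 3 1 tab19 tabOk19 search19
      (by norm_num) (by norm_num) B γ a χ hB hγ ha hχ hγpos hlcm hvan hlb
      (by norm_num at h4 h5 hother ⊢; linarith) hother
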